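/- arXiv:2012.12979 — 2 statements merged into one kernel-verified Lean document; each statement's English description precedes it below -/
import Mathlib

section
/- Let a₀,a₁,a₂,a₃,a₄,ν be real numbers with ν ≠ 1, and let P, F, H be as defined. Define α₋(x,y) = (x−y)(νx+y)(a₁−a₃xy)/((ν−1)H(x,y)). Then at every point (x,y) ∈ ℝ² with x ≠ y, νx+y ≠ 0, H(x,y) ≠ 0 and F(x,y) ≠ 0, the function α₋ satisfies the anti-self-dual scalar equation in Weyl coordinates: ∂x( (P(x)/(x−y)²)·∂x α₋ ) − ∂y( (P(y)/(x−y)²)·∂y α₋ ) = (H(x,y)/((x−y)·F(x,y)))·( P(x)·(∂x α₋)² − P(y)·(∂y α₋)² ). -/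
open Filter Topology

/-- The reduced denominator `H / (νx+y)` in the Chen–Teo potential. -/
def chenTeoK (a₀ a₁ a₃ a₄ ν x y : ℝ) : ℝ :=
  (ν*x - y)*(a₁ - a₃*x*y) - 2*(1 - ν)*(a₀ - a₄*x^2*y^2)

/-- The derivative of `chenTeoK` in `x`. -/
def chenTeoKx (a₁ a₃ a₄ ν x y : ℝ) : ℝ :=
  ν*(a₁ - a₃*x*y) - (ν*x - y)*(a₃*y) + 4*(1 - ν)*a₄*x*y^2

/-- The derivative of `chenTeoK` in `y`. -/
def chenTeoKy (a₁ a₃ a₄ ν x y : ℝ) : ℝ :=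
  -(a₁ - a₃*x*y) - (ν*x - y)*(a₃*x) + 4*(1 - ν)*a₄*x^2*y

/-- The numerator of the `x`-derivative of the potential over `chenTeoK ^ 2`. -/
def chenTeoA (a₀ a₁ a₃ a₄ x y : ℝ) : ℝ :=
  (a₁ - a₃*x*y - a₃*y*(x - y))*(x*(a₁ - a₃*x*y) + 2*(a₀ - a₄*x^2*y^2))
    - (x - y)*(a₁ - a₃*x*y)*(a₁ - 2*a₃*x*y - 4*a₄*x*y^2)

/-- The numerator of the `y`-derivative of the potential over `chenTeoK ^ 2`. -/
def chenTeoB (a₀ a₁ a₃ a₄ x y : ℝ) : ℝ :=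
  (-(a₁ - a₃*x*y) - a₃*x*(x - y))*(x*(a₁ - a₃*x*y) + 2*(a₀ - a₄*x^2*y^2))
    + (x - y)*(a₁ - a₃*x*y)*(a₃*x^2 + 4*a₄*x^2*y)

/-- The derivative of `chenTeoA` in `x`. -/
def chenTeoAx (a₀ a₁ a₃ a₄ x y : ℝ) : ℝ :=
  -2*a₃*y*(x*(a₁ - a₃*x*y) + 2*(a₀ - a₄*x^2*y^2))
    + (x - y)*(a₁ - a₃*x*y)*(2*a₃*y + 4*a₄*y^2)

/-- The derivative of `chenTeoB` in `y`. -/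
def chenTeoBy (a₀ a₁ a₃ a₄ x y : ℝ) : ℝ :=
  2*a₃*x*(x*(a₁ - a₃*x*y) + 2*(a₀ - a₄*x^2*y^2))
    + (x - y)*(a₁ - a₃*x*y)*(4*a₄*x^2)

theorem hasDerivAt_quadratic (b₀ b₁ b₂ x : ℝ) :
    HasDerivAt (fun t => b₀ + b₁*t + b₂*t^2) (b₁ + 2*b₂*x) x := by
  have h := (((hasDerivAt_id x).const_mul b₁).const_add b₀).add
    (((hasDerivAt_id x).pow 2).const_mul b₂)
  refine (h.congr_deriv ?_).congr_of_eventuallyEq (.of_forall fun t => ?_)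
  · simp; ring
  · simp

theorem hasDerivAt_quartic (b₀ b₁ b₂ b₃ b₄ x : ℝ) :
    HasDerivAt (fun t => b₀ + b₁*t + b₂*t^2 + b₃*t^3 + b₄*t^4)
      (b₁ + 2*b₂*x + 3*b₃*x^2 + 4*b₄*x^3) x := by
  have h := ((hasDerivAt_quadratic b₀ b₁ b₂ x).add
    (((hasDerivAt_id x).pow 3).const_mul b₃)).add (((hasDerivAt_id x).pow 4).const_mul b₄)
  refine (h.congr_deriv ?_).congr_of_eventuallyEq (.of_forall fun t => ?_)
  · simp; ring
  · simp

section Derivatives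

variable (a₀ a₁ a₃ a₄ ν x y : ℝ)

theorem hasDerivAt_chenTeoK_left :
    HasDerivAt (fun t => chenTeoK a₀ a₁ a₃ a₄ ν t y) (chenTeoKx a₁ a₃ a₄ ν x y) x := by
  have h := hasDerivAt_quadratic (-y*a₁ - 2*(1 - ν)*a₀) (ν*a₁ + a₃*y^2)
    (-ν*a₃*y + 2*(1 - ν)*a₄*y^2) x
  refine (h.congr_deriv ?_).congr_of_eventuallyEq (.of_forall fun t => ?_)
  · simp only [chenTeoKx]; ring
  · simp only [chenTeoK]; ring

theorem hasDerivAt_chenTeoK_right :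
    HasDerivAt (fun t => chenTeoK a₀ a₁ a₃ a₄ ν x t) (chenTeoKy a₁ a₃ a₄ ν x y) y := by
  have h := hasDerivAt_quadratic (ν*x*a₁ - 2*(1 - ν)*a₀) (-a₁ - ν*a₃*x^2)
    (a₃*x + 2*(1 - ν)*a₄*x^2) y
  refine (h.congr_deriv ?_).congr_of_eventuallyEq (.of_forall fun t => ?_)
  · simp only [chenTeoKy]; ring
  · simp only [chenTeoK]; ring

theorem hasDerivAt_chenTeoA :
    HasDerivAt (fun t => chenTeoA a₀ a₁ a₃ a₄ t y) (chenTeoAx a₀ a₁ a₃ a₄ x y) x := by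
  have h := hasDerivAt_quadratic
    ((a₁ + a₃*y^2)*(2*a₀) - (-a₁*y)*a₁)
    (2*((-a₃*y)*(2*a₀) - (-a₁*y)*(-a₃*y - 2*a₄*y^2)))
    ((-a₃*y)*a₁ - (a₁ + a₃*y^2)*(-a₃*y - 2*a₄*y^2)) x
  refine (h.congr_deriv ?_).congr_of_eventuallyEq (.of_forall fun t => ?_)
  · simp only [chenTeoAx]; ring
  · simp only [chenTeoA]; ring

theorem hasDerivAt_chenTeoB :
    HasDerivAt (fun t => chenTeoB a₀ a₁ a₃ a₄ x t) (chenTeoBy a₀ a₁ a₃ a₄ x y) y := by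
  have h := hasDerivAt_quadratic
    ((-a₁ - a₃*x^2)*(x*a₁ + 2*a₀) - (a₁*x)*(-a₃*x^2))
    (2*((a₃*x)*(x*a₁ + 2*a₀) - (a₁*x)*(-2*a₄*x^2)))
    ((a₃*x)*(-a₃*x^2) - (-a₁ - a₃*x^2)*(-2*a₄*x^2)) y
  refine (h.congr_deriv ?_).congr_of_eventuallyEq (.of_forall fun t => ?_)
  · simp only [chenTeoBy]; ring
  · simp only [chenTeoB]; ring

theorem hasDerivAt_chenTeo_quotient_left (hν : ν ≠ 1) (hK : chenTeoK a₀ a₁ a₃ a₄ ν x y ≠ 0) :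
    HasDerivAt (fun t => (t - y)*(a₁ - a₃*t*y) / ((ν - 1)*chenTeoK a₀ a₁ a₃ a₄ ν t y))
      (chenTeoA a₀ a₁ a₃ a₄ x y / chenTeoK a₀ a₁ a₃ a₄ ν x y ^ 2) x := by
  have hν' : ν - 1 ≠ 0 := sub_ne_zero.mpr hν
  have hD : HasDerivAt (fun t => (t - y)*(a₁ - a₃*t*y))
      (a₁ + a₃*y^2 - 2*a₃*y*x) x := by
    refine ((hasDerivAt_quadratic (-a₁*y) (a₁ + a₃*y^2) (-a₃*y) x).congr_deriv
      (by ring)).congr_of_eventuallyEq (.of_forall fun t => by ring)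
  refine (hD.div ((hasDerivAt_chenTeoK_left a₀ a₁ a₃ a₄ ν x y).const_mul (ν - 1))
    (mul_ne_zero hν' hK)).congr_deriv ?_
  rw [div_eq_div_iff (pow_ne_zero 2 (mul_ne_zero hν' hK)) (pow_ne_zero 2 hK)]
  simp only [chenTeoK, chenTeoKx, chenTeoA]
  ring

theorem hasDerivAt_chenTeo_quotient_right (hν : ν ≠ 1) (hK : chenTeoK a₀ a₁ a₃ a₄ ν x y ≠ 0) :
    HasDerivAt (fun t => (x - t)*(a₁ - a₃*x*t) / ((ν - 1)*chenTeoK a₀ a₁ a₃ a₄ ν x t))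
      (chenTeoB a₀ a₁ a₃ a₄ x y / chenTeoK a₀ a₁ a₃ a₄ ν x y ^ 2) y := by
  have hν' : ν - 1 ≠ 0 := sub_ne_zero.mpr hν
  have hD : HasDerivAt (fun t => (x - t)*(a₁ - a₃*x*t))
      (-a₁ - a₃*x^2 + 2*a₃*x*y) y := by
    refine ((hasDerivAt_quadratic (a₁*x) (-a₁ - a₃*x^2) (a₃*x) y).congr_deriv
      (by ring)).congr_of_eventuallyEq (.of_forall fun t => by ring)
  refine (hD.div ((hasDerivAt_chenTeoK_right a₀ a₁ a₃ a₄ ν x y).const_mul (ν - 1))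
    (mul_ne_zero hν' hK)).congr_deriv ?_
  rw [div_eq_div_iff (pow_ne_zero 2 (mul_ne_zero hν' hK)) (pow_ne_zero 2 hK)]
  simp only [chenTeoK, chenTeoKy, chenTeoB]
  ring

end Derivatives

theorem hasDerivAt_flux {p n k : ℝ → ℝ} {p' n' k' x : ℝ} (c : ℝ) (hp : HasDerivAt p p' x)
    (hn : HasDerivAt n n' x) (hk : HasDerivAt k k' x) (hx : x - c ≠ 0) (hkx : k x ≠ 0) :
    HasDerivAt (fun t => p t / (t - c)^2 * (n t / k t ^ 2))
      (((p'*n x + p x*n')*(x - c)*k x - 2*p x*n x*k x - 2*p x*n x*(x - c)*k')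
        / ((x - c)^3*k x ^ 3)) x := by
  have h := (hp.div (((hasDerivAt_id x).sub_const c).pow 2) (pow_ne_zero 2 hx)).mul
    (hn.div (hk.pow 2) (pow_ne_zero 2 hkx))
  refine h.congr_deriv ?_
  simp only [Pi.pow_apply, Pi.div_apply, id]
  field_simp
  ring

/-- The polynomial identity to which the anti-self-dual equation reduces after clearing
denominators. -/
theorem chenTeo_polynomial_identity (a₀ a₁ a₂ a₃ a₄ ν x y p p' q q' : ℝ)
    (hp : p = a₀ + a₁*x + a₂*x^2 + a₃*x^3 + a₄*x^4)
    (hp' : p' = a₁ + 2*a₂*x + 3*a₃*x^2 + 4*a₄*x^3)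
    (hq : q = a₀ + a₁*y + a₂*y^2 + a₃*y^3 + a₄*y^4)
    (hq' : q' = a₁ + 2*a₂*y + 3*a₃*y^2 + 4*a₄*y^3)
    (K Kx Ky A B Ax By : ℝ)
    (hK : K = chenTeoK a₀ a₁ a₃ a₄ ν x y)
    (hKx : Kx = chenTeoKx a₁ a₃ a₄ ν x y)
    (hKy : Ky = chenTeoKy a₁ a₃ a₄ ν x y)
    (hA : A = chenTeoA a₀ a₁ a₃ a₄ x y)
    (hB : B = chenTeoB a₀ a₁ a₃ a₄ x y)
    (hAx : Ax = chenTeoAx a₀ a₁ a₃ a₄ x y)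
    (hBy : By = chenTeoBy a₀ a₁ a₃ a₄ x y) :
    (y^2*p - x^2*q) *
      (((p'*A + p*Ax)*(x - y)*K - 2*p*A*K - 2*p*A*(x - y)*Kx)
        - ((q'*B + q*By)*(x - y)*K + 2*q*B*K - 2*q*B*(x - y)*Ky))
      = (ν*x + y)*(x - y)^2*(p*A^2 - q*B^2) := by
  subst_vars
  simp only [chenTeoK, chenTeoKx, chenTeoKy, chenTeoA, chenTeoB, chenTeoAx, chenTeoBy]
  ring


/-- The function `α₋(x,y) = (x−y)(νx+y)(a₁−a₃xy)/((ν−1)H(x,y))` satisfies the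
anti-self-dual scalar equation in Weyl coordinates for the Chen–Teo family. -/
theorem chenTeo_antiSelfDual_potential
    (a₀ a₁ a₂ a₃ a₄ ν : ℝ) (hν : ν ≠ 1)
    (P : ℝ → ℝ) (hP : ∀ u, P u = a₀ + a₁*u + a₂*u^2 + a₃*u^3 + a₄*u^4)
    (F H : ℝ → ℝ → ℝ)
    (hF : ∀ x y, F x y = y^2 * P x - x^2 * P y)
    (hH : ∀ x y, H x y =
      (ν*x + y) * ((ν*x - y)*(a₁ - a₃*x*y) - 2*(1 - ν)*(a₀ - a₄*x^2*y^2)))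
    (α : ℝ → ℝ → ℝ)
    (hα : ∀ x y, α x y = (x - y)*(ν*x + y)*(a₁ - a₃*x*y) / ((ν - 1)*(H x y)))
    (αx αy : ℝ → ℝ → ℝ)
    (hαx : ∀ x y, αx x y = deriv (fun t => α t y) x)
    (hαy : ∀ x y, αy x y = deriv (fun t => α x t) y)
    (x y : ℝ) (hxy : x ≠ y) (hne : ν*x + y ≠ 0)
    (hHne : H x y ≠ 0) (hFne : F x y ≠ 0) :
    deriv (fun t => P t / (t - y)^2 * αx t y) x
      - deriv (fun t => P t / (x - t)^2 * αy x t) y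
    = H x y / ((x - y) * F x y) *
        (P x * (αx x y)^2 - P y * (αy x y)^2) := by
  have H_eq : ∀ s t, H s t = (ν*s + t) * chenTeoK a₀ a₁ a₃ a₄ ν s t := fun s t => by
    rw [hH, chenTeoK]
  have α_eq : ∀ s t, ν*s + t ≠ 0 →
      α s t = (s - t)*(a₁ - a₃*s*t) / ((ν - 1)*chenTeoK a₀ a₁ a₃ a₄ ν s t) := by
    intro s t hst
    rw [hα, H_eq, mul_right_comm, mul_left_comm, mul_comm _ (ν*s + t), mul_div_mul_left _ _ hst]
  have lin_left : ∀ s t, ν*s + t ≠ 0 → ∀ᶠ r in 𝓝 s, ν*r + t ≠ 0 := fun s t hst =>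
    ContinuousAt.eventually_ne (by fun_prop) hst
  have lin_right : ∀ s t, ν*s + t ≠ 0 → ∀ᶠ r in 𝓝 t, ν*s + r ≠ 0 := fun s t hst =>
    ContinuousAt.eventually_ne (by fun_prop) hst
  have αx_eq : ∀ s t, ν*s + t ≠ 0 → chenTeoK a₀ a₁ a₃ a₄ ν s t ≠ 0 →
      αx s t = chenTeoA a₀ a₁ a₃ a₄ s t / chenTeoK a₀ a₁ a₃ a₄ ν s t ^ 2 := by
    intro s t hst hK
    rw [hαx]
    exact ((hasDerivAt_chenTeo_quotient_left a₀ a₁ a₃ a₄ ν s t hν hK).congr_of_eventuallyEq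
      ((lin_left s t hst).mono fun r hr => α_eq r t hr)).deriv
  have αy_eq : ∀ s t, ν*s + t ≠ 0 → chenTeoK a₀ a₁ a₃ a₄ ν s t ≠ 0 →
      αy s t = chenTeoB a₀ a₁ a₃ a₄ s t / chenTeoK a₀ a₁ a₃ a₄ ν s t ^ 2 := by
    intro s t hst hK
    rw [hαy]
    exact ((hasDerivAt_chenTeo_quotient_right a₀ a₁ a₃ a₄ ν s t hν hK).congr_of_eventuallyEq
      ((lin_right s t hst).mono fun r hr => α_eq s r hr)).deriv
  have hK : chenTeoK a₀ a₁ a₃ a₄ ν x y ≠ 0 := right_ne_zero_of_mul (H_eq x y ▸ hHne)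
  have hsub : x - y ≠ 0 := sub_ne_zero.mpr hxy
  have hsub' : y - x ≠ 0 := sub_ne_zero.mpr hxy.symm
  have hKx := hasDerivAt_chenTeoK_left a₀ a₁ a₃ a₄ ν x y
  have hKy := hasDerivAt_chenTeoK_right a₀ a₁ a₃ a₄ ν x y
  have P_deriv : ∀ u, HasDerivAt P (a₁ + 2*a₂*u + 3*a₃*u^2 + 4*a₄*u^3) u := fun u =>
    (funext hP : P = _) ▸ hasDerivAt_quartic a₀ a₁ a₂ a₃ a₄ u
  have flux_x := ((hasDerivAt_flux y (P_deriv x) (hasDerivAt_chenTeoA a₀ a₁ a₃ a₄ x y) hKx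
    hsub hK).congr_of_eventuallyEq (f₁ := fun t => P t / (t - y)^2 * αx t y) (by
      filter_upwards [lin_left x y hne, hKx.continuousAt.eventually_ne hK] with r hr hKr
      rw [αx_eq r y hr hKr])).deriv
  have flux_y := ((hasDerivAt_flux x (P_deriv y) (hasDerivAt_chenTeoB a₀ a₁ a₃ a₄ x y) hKy
    hsub' hK).congr_of_eventuallyEq (f₁ := fun t => P t / (x - t)^2 * αy x t) (by
      filter_upwards [lin_right x y hne, hKy.continuousAt.eventually_ne hK] with r hr hKr
      rw [αy_eq x r hr hKr, sub_sq_comm])).deriv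
  rw [flux_x, flux_y, αx_eq x y hne hK, αy_eq x y hne hK, H_eq]
  have key := chenTeo_polynomial_identity a₀ a₁ a₂ a₃ a₄ ν x y (P x) _ (P y) _
    (hP x) rfl (hP y) rfl _ _ _ _ _ _ _ rfl rfl rfl rfl rfl rfl rfl
  rw [← hF] at key
  generalize chenTeoK a₀ a₁ a₃ a₄ ν x y = K at *
  generalize chenTeoA a₀ a₁ a₃ a₄ x y = A at *
  generalize chenTeoB a₀ a₁ a₃ a₄ x y = B at *
  generalize a₁ + 2*a₂*x + 3*a₃*x^2 + 4*a₄*x^3 = p' at *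
  generalize a₁ + 2*a₂*y + 3*a₃*y^2 + 4*a₄*y^3 = q' at *
  rw [show (y - x)^3 * K^3 = -((x - y)^3 * K^3) by ring, div_neg, sub_neg_eq_add, ← add_div]
  have rhs_eq : (ν*x + y)*K / ((x - y)*F x y) * (P x*(A/K^2)^2 - P y*(B/K^2)^2)
      = (ν*x + y)*(P x*A^2 - P y*B^2) / ((x - y)*F x y*K^3) := by
    field_simp
  rw [rhs_eq, div_eq_div_iff (by positivity) (by positivity)]
  linear_combination (x - y)*K^3 * key
end

section
/- Let a₀,a₁,a₂,a₃,a₄,ν be real numbers with ν ≠ 1, and let P, F, H be as defined. Define α₋(x,y) = (x−y)(νx+y)(a₁−a₃xy)/((ν−1)H(x,y)) and α₂(x,y) = (x−y)(νx+y)/((ν−1)H(x,y)). Then at every point (x,y) ∈ ℝ² with x ≠ y, νx+y ≠ 0, H(x,y) ≠ 0 and F(x,y) ≠ 0, the function α₂ satisfies the anti-self-dual scalar equation in Weyl coordinates: ∂x( (P(x)/(x−y)²)·∂x α₂ ) − ∂y( (P(y)/(x−y)²)·∂y α₂ ) = (H(x,y)/((x−y)·F(x,y)))·( P(x)·(∂x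 α₋)(∂x α₂) − P(y)·(∂y α₋)(∂y α₂) ). -/
/-- The cofactor of `νx + y` in `H`. -/
def cofactorG (a₀ a₁ a₃ a₄ ν x y : ℝ) : ℝ :=
  (ν*x - y)*(a₁ - a₃*x*y) - 2*(1 - ν)*(a₀ - a₄*x^2*y^2)

/-- The partial derivative of `cofactorG` in its first variable. -/
def cofactorGx (a₁ a₃ a₄ ν x y : ℝ) : ℝ :=
  ν*(a₁ - a₃*x*y) - (ν*x - y)*(a₃*y) + 4*(1 - ν)*(a₄*x*y^2)

/-- The partial derivative of `cofactorG` in its second variable. -/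
def cofactorGy (a₁ a₃ a₄ ν x y : ℝ) : ℝ :=
  -(a₁ - a₃*x*y) - (ν*x - y)*(a₃*x) + 4*(1 - ν)*(a₄*x^2*y)

lemma hasDerivAt_cofactorG_left (a₀ a₁ a₃ a₄ ν x y : ℝ) :
    HasDerivAt (fun t => cofactorG a₀ a₁ a₃ a₄ ν t y) (cofactorGx a₁ a₃ a₄ ν x y) x := by
  have hx := hasDerivAt_id' x
  have h := ((hx.const_mul ν).sub_const y).mul (((hx.const_mul a₃).mul_const y).const_sub a₁)
    |>.sub (((((hx.pow 2).const_mul a₄).mul_const (y^2)).const_sub a₀).const_mul (2*(1 - ν)))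
  refine h.congr_deriv ?_
  simp only [cofactorGx]
  push_cast
  ring

lemma hasDerivAt_cofactorG_right (a₀ a₁ a₃ a₄ ν x y : ℝ) :
    HasDerivAt (fun t => cofactorG a₀ a₁ a₃ a₄ ν x t) (cofactorGy a₁ a₃ a₄ ν x y) y := by
  have hy := hasDerivAt_id' y
  have h := (hy.const_sub (ν*x)).mul ((hy.const_mul (a₃*x)).const_sub a₁)
    |>.sub ((((hy.pow 2).const_mul (a₄*x^2)).const_sub a₀).const_mul (2*(1 - ν)))
  refine h.congr_deriv ?_
  simp only [cofactorGy]
  push_cast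
  ring

lemma hasDerivAt_cofactorGx_left (a₁ a₃ a₄ ν x y : ℝ) :
    HasDerivAt (fun t => cofactorGx a₁ a₃ a₄ ν t y)
      (-2*ν*a₃*y + 4*(1 - ν)*a₄*y^2) x := by
  have hx := hasDerivAt_id' x
  have h := ((((hx.const_mul a₃).mul_const y).const_sub a₁).const_mul ν
    |>.sub (((hx.const_mul ν).sub_const y).mul_const (a₃*y))).add
      (((hx.const_mul a₄).mul_const (y^2)).const_mul (4*(1 - ν)))
  exact h.congr_deriv (by ring)

lemma hasDerivAt_cofactorGy_right (a₁ a₃ a₄ ν x y : ℝ) :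
    HasDerivAt (fun t => cofactorGy a₁ a₃ a₄ ν x t)
      (2*a₃*x + 4*(1 - ν)*a₄*x^2) y := by
  have hy := hasDerivAt_id' y
  have h := (((hy.const_mul (a₃*x)).const_sub a₁).neg
    |>.sub ((hy.const_sub (ν*x)).mul_const (a₃*x))).add
      ((hy.const_mul (a₄*x^2)).const_mul (4*(1 - ν)))
  exact h.congr_deriv (by ring)

lemma hasDerivAt_quartic_s2 (a₀ a₁ a₂ a₃ a₄ u : ℝ) :
    HasDerivAt (fun t => a₀ + a₁*t + a₂*t^2 + a₃*t^3 + a₄*t^4)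
      (a₁ + 2*a₂*u + 3*a₃*u^2 + 4*a₄*u^3) u := by
  have hu := hasDerivAt_id' u
  have h := ((((hu.const_mul a₁).const_add a₀).add ((hu.pow 2).const_mul a₂)).add
    ((hu.pow 3).const_mul a₃)).add ((hu.pow 4).const_mul a₄)
  refine h.congr_deriv ?_
  push_cast
  ring

/-- The derivative of the flux of `(s - c) / (g * G s)` with weight `p s / (s - c)^2`. -/
lemma hasDerivAt_flux_s2 {p G G' : ℝ → ℝ} {p' G'' g c t : ℝ}
    (hp : HasDerivAt p p' t) (hG : HasDerivAt G (G' t) t) (hG' : HasDerivAt G' G'' t)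
    (hg : g ≠ 0) (htc : t - c ≠ 0) (hGt : G t ≠ 0) :
    HasDerivAt (fun s => p s / (s - c)^2 * ((G s - (s - c) * G' s) / (g * G s ^ 2)))
      (((p' * (t - c) - 2 * p t) * (G t - (t - c) * G' t) * G t
        - p t * (t - c)^2 * G'' * G t - 2 * p t * (t - c) * (G t - (t - c) * G' t) * G' t)
        / (g * (t - c)^3 * G t ^ 3)) t := by
  have hs := (hasDerivAt_id' t).sub_const c
  have h := (hp.div (hs.pow 2) (pow_ne_zero 2 htc)).mul
    ((hG.sub (hs.mul hG')).div ((hG.pow 2).const_mul g) (mul_ne_zero hg (pow_ne_zero 2 hGt)))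
  refine h.congr_deriv ?_
  simp only [Pi.pow_apply, Pi.mul_apply, Pi.sub_apply, Pi.div_apply]
  push_cast
  field_simp
  ring

lemma hasDerivAt_sub_div {G : ℝ → ℝ} {G' g c t : ℝ} (hG : HasDerivAt G G' t)
    (hg : g ≠ 0) (hGt : G t ≠ 0) :
    HasDerivAt (fun s => (s - c) / (g * G s)) ((G t - (t - c) * G') / (g * G t ^ 2)) t := by
  have h := ((hasDerivAt_id' t).sub_const c).div (hG.const_mul g) (mul_ne_zero hg hGt)
  refine h.congr_deriv ?_
  field_simp

lemma hasDerivAt_mul_sub_div {A G : ℝ → ℝ} {A' G' g c t : ℝ} (hA : HasDerivAt A A' t)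
    (hG : HasDerivAt G G' t) (hg : g ≠ 0) (hGt : G t ≠ 0) :
    HasDerivAt (fun s => A s * ((s - c) / (g * G s)))
      ((A t * (G t - (t - c) * G') + (t - c) * A' * G t) / (g * G t ^ 2)) t := by
  refine (hA.mul (hasDerivAt_sub_div (c := c) hG hg hGt)).congr_deriv ?_
  field_simp
  ring

lemma chenTeo_flux_identity (a₀ a₁ a₂ a₃ a₄ ν x y : ℝ) {p q A G G₁ G₂ : ℝ}
    (hp : p = a₀ + a₁*x + a₂*x^2 + a₃*x^3 + a₄*x^4)
    (hq : q = a₀ + a₁*y + a₂*y^2 + a₃*y^3 + a₄*y^4)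
    (hA : A = a₁ - a₃*x*y)
    (hG : G = cofactorG a₀ a₁ a₃ a₄ ν x y)
    (hG₁ : G₁ = cofactorGx a₁ a₃ a₄ ν x y)
    (hG₂ : G₂ = cofactorGy a₁ a₃ a₄ ν x y) :
    (ν - 1) * (y^2 * p - x^2 * q) *
      ((((a₁ + 2*a₂*x + 3*a₃*x^2 + 4*a₄*x^3) * (x - y) - 2 * p) * (G - (x - y) * G₁) * G
        - p * (x - y)^2 * (-2*ν*a₃*y + 4*(1 - ν)*a₄*y^2) * G
        - 2 * p * (x - y) * (G - (x - y) * G₁) * G₁)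
      - (((a₁ + 2*a₂*y + 3*a₃*y^2 + 4*a₄*y^3) * (y - x) - 2 * q) * (G - (y - x) * G₂) * G
        - q * (y - x)^2 * (2*a₃*x + 4*(1 - ν)*a₄*x^2) * G
        - 2 * q * (y - x) * (G - (y - x) * G₂) * G₂))
    = (x - y)^2 * (ν*x + y) *
      (p * (A * (G - (x - y) * G₁) - (x - y) * (a₃*y) * G) * (G - (x - y) * G₁)
      - q * (A * (G - (y - x) * G₂) - (y - x) * (a₃*x) * G) * (G - (y - x) * G₂)) := by
  subst hp hq hA hG hG₁ hG₂
  simp only [cofactorG, cofactorGx, cofactorGy]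
  ring

/-- The function `α₂(x,y) = (x−y)(νx+y)/((ν−1)H(x,y))` satisfies the
anti-self-dual scalar equation (with coefficient potential `α₋`) in Weyl
coordinates for the Chen–Teo family. -/
theorem chenTeo_antiSelfDual_second_potential
    (a₀ a₁ a₂ a₃ a₄ ν : ℝ) (hν : ν ≠ 1)
    (P : ℝ → ℝ) (hP : ∀ u, P u = a₀ + a₁*u + a₂*u^2 + a₃*u^3 + a₄*u^4)
    (F H : ℝ → ℝ → ℝ)
    (hF : ∀ x y, F x y = y^2 * P x - x^2 * P y)
    (hH : ∀ x y, H x y =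
      (ν*x + y) * ((ν*x - y)*(a₁ - a₃*x*y) - 2*(1 - ν)*(a₀ - a₄*x^2*y^2)))
    (αm α₂ : ℝ → ℝ → ℝ)
    (hαm : ∀ x y, αm x y = (x - y)*(ν*x + y)*(a₁ - a₃*x*y) / ((ν - 1)*(H x y)))
    (hα₂ : ∀ x y, α₂ x y = (x - y)*(ν*x + y) / ((ν - 1)*(H x y)))
    (αmx αmy α₂x α₂y : ℝ → ℝ → ℝ)
    (hαmx : ∀ x y, αmx x y = deriv (fun t => αm t y) x)
    (hαmy : ∀ x y, αmy x y = deriv (fun t => αm x t) y)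
    (hα₂x : ∀ x y, α₂x x y = deriv (fun t => α₂ t y) x)
    (hα₂y : ∀ x y, α₂y x y = deriv (fun t => α₂ x t) y)
    (x y : ℝ) (hxy : x ≠ y) (hne : ν*x + y ≠ 0)
    (hHne : H x y ≠ 0) (hFne : F x y ≠ 0) :
    deriv (fun t => P t / (t - y)^2 * α₂x t y) x
      - deriv (fun t => P t / (x - t)^2 * α₂y x t) y
    = H x y / ((x - y) * F x y) *
        (P x * (αmx x y) * (α₂x x y) - P y * (αmy x y) * (α₂y x y)) := by
  have hg : ν - 1 ≠ 0 := sub_ne_zero.mpr hν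
  have hg' : -(ν - 1) ≠ 0 := neg_ne_zero.mpr hg
  have hd : x - y ≠ 0 := sub_ne_zero.mpr hxy
  have hd' : y - x ≠ 0 := sub_ne_zero.mpr hxy.symm
  let G := cofactorG a₀ a₁ a₃ a₄ ν
  let G₁ := cofactorGx a₁ a₃ a₄ ν
  let G₂ := cofactorGy a₁ a₃ a₄ ν
  have hHG : ∀ u v, H u v = (ν*u + v) * G u v := hH
  have hG : G x y ≠ 0 := fun h => hHne (by rw [hHG, h, mul_zero])
  have hα₂G : ∀ u v, ν*u + v ≠ 0 → α₂ u v = (u - v) / ((ν - 1) * G u v) := by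
    intro u v h
    rw [hα₂, hHG, mul_left_comm, mul_comm (u - v), mul_div_mul_left _ _ h]
  have hα₂G' : ∀ u v, ν*u + v ≠ 0 → α₂ u v = (v - u) / (-(ν - 1) * G u v) := by
    intro u v h
    rw [hα₂G u v h, neg_mul, div_neg, ← neg_div, neg_sub]
  have hαmα₂ : ∀ u v, αm u v = (a₁ - a₃*u*v) * α₂ u v := by
    intro u v
    rw [hαm, hα₂]
    ring
  have hline₁ : ∀ᶠ t in nhds x, ν*t + y ≠ 0 :=
    ContinuousAt.eventually_ne (g := fun t => ν*t + y) (by fun_prop) hne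
  have hline₂ : ∀ᶠ t in nhds y, ν*x + t ≠ 0 :=
    ContinuousAt.eventually_ne (g := fun t => ν*x + t) (by fun_prop) hne
  have hG₁d : ∀ t, HasDerivAt (fun s => G s y) (G₁ t y) t := fun t =>
    hasDerivAt_cofactorG_left a₀ a₁ a₃ a₄ ν t y
  have hG₂d : ∀ t, HasDerivAt (fun s => G x s) (G₂ x t) t := fun t =>
    hasDerivAt_cofactorG_right a₀ a₁ a₃ a₄ ν x t
  have hGne₁ : ∀ᶠ t in nhds x, G t y ≠ 0 := (hG₁d x).continuousAt.eventually_ne hG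
  have hGne₂ : ∀ᶠ t in nhds y, G x t ≠ 0 := (hG₂d y).continuousAt.eventually_ne hG
  have hα₂x_eq : ∀ᶠ t in nhds x,
      α₂x t y = (G t y - (t - y) * G₁ t y) / ((ν - 1) * G t y ^ 2) := by
    filter_upwards [hline₁.eventually_nhds, hGne₁] with t ht hGt
    rw [hα₂x]
    exact ((hasDerivAt_sub_div (hG₁d t) hg hGt).congr_of_eventuallyEq
      (ht.mono fun s hs => hα₂G s y hs)).deriv
  have hα₂y_eq : ∀ᶠ t in nhds y,
      α₂y x t = (G x t - (t - x) * G₂ x t) / (-(ν - 1) * G x t ^ 2) := by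
    filter_upwards [hline₂.eventually_nhds, hGne₂] with t ht hGt
    rw [hα₂y]
    exact ((hasDerivAt_sub_div (hG₂d t) hg' hGt).congr_of_eventuallyEq
      (ht.mono fun s hs => hα₂G' x s hs)).deriv
  have hαmx_eq : αmx x y = ((a₁ - a₃*x*y) * (G x y - (x - y) * G₁ x y)
      + (x - y) * -(a₃*y) * G x y) / ((ν - 1) * G x y ^ 2) := by
    rw [hαmx]
    have hA : HasDerivAt (fun t => a₁ - a₃*t*y) (-(a₃*y)) x :=
      ((((hasDerivAt_id' x).const_mul a₃).mul_const y).const_sub a₁).congr_deriv (by ring)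
    exact ((hasDerivAt_mul_sub_div hA (hG₁d x) hg hG).congr_of_eventuallyEq
      (hline₁.mono fun s hs => by simp only [hαmα₂, hα₂G s y hs])).deriv
  have hαmy_eq : αmy x y = ((a₁ - a₃*x*y) * (G x y - (y - x) * G₂ x y)
      + (y - x) * -(a₃*x) * G x y) / (-(ν - 1) * G x y ^ 2) := by
    rw [hαmy]
    have hA : HasDerivAt (fun t => a₁ - a₃*x*t) (-(a₃*x)) y :=
      (((hasDerivAt_id' y).const_mul (a₃*x)).const_sub a₁).congr_deriv (by ring)
    exact ((hasDerivAt_mul_sub_div hA (hG₂d y) hg' hG).congr_of_eventuallyEq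
      (hline₂.mono fun s hs => by simp only [hαmα₂, hα₂G' x s hs])).deriv
  have hPd : ∀ u, HasDerivAt P (a₁ + 2*a₂*u + 3*a₃*u^2 + 4*a₄*u^3) u := by
    intro u
    rw [funext hP]
    exact hasDerivAt_quartic_s2 a₀ a₁ a₂ a₃ a₄ u
  have hflux₁ := ((hasDerivAt_flux_s2 (G := fun t => G t y) (G' := fun t => G₁ t y) (hPd x)
    (hG₁d x) (hasDerivAt_cofactorGx_left a₁ a₃ a₄ ν x y) hg hd hG).congr_of_eventuallyEq
      (f₁ := fun t => P t / (t - y)^2 * α₂x t y)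
      (hα₂x_eq.mono fun t ht => by simp only [ht])).deriv
  have hflux₂ := ((hasDerivAt_flux_s2 (G := fun t => G x t) (G' := fun t => G₂ x t) (hPd y)
    (hG₂d y) (hasDerivAt_cofactorGy_right a₁ a₃ a₄ ν x y) hg' hd' hG).congr_of_eventuallyEq
      (f₁ := fun t => P t / (x - t)^2 * α₂y x t)
      (hα₂y_eq.mono fun t ht => by simp only [ht, sub_sq_comm x t])).deriv
  have key := chenTeo_flux_identity a₀ a₁ a₂ a₃ a₄ ν x y (hP x) (hP y) rfl
    (rfl : G x y = _) (rfl : G₁ x y = _) (rfl : G₂ x y = _)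
  rw [hF] at hFne
  rw [hflux₁, hflux₂, hαmx_eq, hαmy_eq, hα₂x_eq.self_of_nhds, hα₂y_eq.self_of_nhds, hHG, hF]
  have hden : -(ν - 1) * (y - x)^3 = (ν - 1) * (x - y)^3 := by ring
  rw [hden]
  generalize G x y = g at *
  generalize G₁ x y = g₁ at *
  generalize G₂ x y = g₂ at *
  generalize P x = p at *
  generalize P y = q at *
  generalize a₁ - a₃*x*y = A at *
  rw [← sub_div, div_eq_iff (by positivity)]
  have hsum : ∀ D N₁ N₂ M₁ M₂ : ℝ, (ν*x + y) * g / ((x - y) * D) *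
      (p * (M₁ / ((ν - 1) * g^2)) * (N₁ / ((ν - 1) * g^2))
        - q * (M₂ / (-(ν - 1) * g^2)) * (N₂ / (-(ν - 1) * g^2))) * ((ν - 1) * (x - y)^3 * g^3)
      = (x - y)^2 * (ν*x + y) * (p * M₁ * N₁ - q * M₂ * N₂) / ((ν - 1) * D) := by
    intro D N₁ N₂ M₁ M₂
    field_simp
  rw [hsum, eq_div_iff (mul_ne_zero hg hFne)]
  linear_combination key
end
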